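/- Let ℓ > 0 and let γ : ℝ → ℝ³ be a smooth ℓ-periodic curve parametrized by arc length (‖γ′(α)‖ = 1 for all α) whose curvature κ(α) := ‖γ″(α)‖ is strictly positive everywhere. Let e₁ := γ″/κ be the unit normal, e₂ := γ′ × e₁ the unit binormal, and τ := ((γ′ × γ″)·γ‴)/κ² the torsion. Let f : ℝ → ℝ be smooth and ℓ-periodic, and for η > 0 define the perturbed curve γ_η(α) := γ(α) − η³·f(α)·( e₁(α)·cos(α/η) + e₂(α)·sin(α/η) ). Then there exist constants C > 0 and η₀ > 0 such that for all η ∈ (0, η₀) and all α ∈ ℝ: (i) | ‖γ_η′(α)‖² − 1 | ≤ C·η²; (ii) γ_η′(α) × γ_η″(α) ≠ 0, so the curvature κ_η := ‖γ_η′ × γ_η″‖/‖γ_η′‖³ and torsion τ_η := ((γ_η′ × γ_η″)·γ_η‴)/‖γ_η′ × γ_η″‖² are well defined; (iii) | κ_η(α) − κ(α) | ≤ C·η; and (iv) | τ_η(α) − τ(α) − (f(α)/κ(α))·cos(α/η) | ≤ C·η. -/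

import Mathlib

noncomputable section

/-- Euclidean 3-space. -/
abbrev E3 := EuclideanSpace ℝ (Fin 3)

/-- Build a point of Euclidean 3-space from a plain function. -/
def toE3 (v : Fin 3 → ℝ) : E3 := (WithLp.equiv 2 (Fin 3 → ℝ)).symm v

/-- Euclidean inner product on `E3`. -/
def dot3 (a b : E3) : ℝ := a 0 * b 0 + a 1 * b 1 + a 2 * b 2

/-- Cross product on `E3`. -/
def cross3 (a b : E3) : E3 :=
  toE3 ![a 1 * b 2 - a 2 * b 1, a 2 * b 0 - a 0 * b 2, a 0 * b 1 - a 1 * b 0]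

open Filter Topology Asymptotics

/-! ### Approximation of bounded functions up to a given rate -/

/-- Two functions, bounded along `l`, that agree up to `O(u)`. -/
structure Approx {X : Type*} (l : Filter X) (u F G : X → ℝ) : Prop where
  sub : (fun x => F x - G x) =O[l] u
  left : F =O[l] (fun _ => (1 : ℝ))
  right : G =O[l] (fun _ => (1 : ℝ))

namespace Approx

variable {X : Type*} {l : Filter X} {u F G F' G' : X → ℝ}

theorem of_sub (hu : Tendsto u l (𝓝 0)) (h : (fun x => F x - G x) =O[l] u)
    (hG : G =O[l] (fun _ => (1 : ℝ))) : Approx l u F G where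
  sub := h
  left := by
    simpa using (h.trans (hu.isBigO_one ℝ)).add hG
  right := hG

theorem add (h : Approx l u F G) (h' : Approx l u F' G') :
    Approx l u (fun x => F x + F' x) (fun x => G x + G' x) where
  sub := (h.sub.add h'.sub).congr_left fun x => by ring
  left := h.left.add h'.left
  right := h.right.add h'.right

theorem mul (h : Approx l u F G) (h' : Approx l u F' G') :
    Approx l u (fun x => F x * F' x) (fun x => G x * G' x) where
  sub := by
    have h1 := h.sub.mul h'.left
    have h2 := h.right.mul h'.sub
    simp only [mul_one, one_mul] at h1 h2
    exact (h1.add h2).congr_left fun x => by ring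
  left := by simpa using h.left.mul h'.left
  right := by simpa using h.right.mul h'.right

theorem sub' (h : Approx l u F G) (h' : Approx l u F' G') :
    Approx l u (fun x => F x - F' x) (fun x => G x - G' x) where
  sub := (h.sub.sub h'.sub).congr_left fun x => by ring
  left := h.left.sub h'.left
  right := h.right.sub h'.right

theorem pow (h : Approx l u F G) (n : ℕ) :
    Approx l u (fun x => F x ^ n) (fun x => G x ^ n) := by
  induction n with
  | zero =>
    simp only [pow_zero]
    exact ⟨by simpa using isBigO_zero u l, isBigO_refl _ _, isBigO_refl _ _⟩
  | succ n ih => simpa only [pow_succ] using ih.mul h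

theorem eventually_ne_zero (hu : Tendsto u l (𝓝 0)) (h : Approx l u F G) (hG : ∀ x, G x ≠ 0)
    (hGinv : (fun x => (G x)⁻¹) =O[l] (fun _ => (1 : ℝ))) :
    ∀ᶠ x in l, F x ≠ 0 ∧ |(F x)⁻¹| ≤ 2 * |(G x)⁻¹| := by
  have h1 := h.sub.mul hGinv
  simp only [mul_one] at h1
  filter_upwards [(h1.trans_tendsto hu).eventually
    (Metric.ball_mem_nhds 0 (by norm_num : (0 : ℝ) < 1 / 2))] with x hx
  rw [dist_zero_right, Real.norm_eq_abs, ← div_eq_mul_inv, sub_div,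
    div_self (hG x), abs_lt] at hx
  have hpos : 1 / 2 < F x / G x := by linarith [hx.1]
  have hF : F x ≠ 0 := fun h0 => by norm_num [h0] at hpos
  refine ⟨hF, ?_⟩
  have : (F x)⁻¹ = (F x / G x)⁻¹ * (G x)⁻¹ := by
    have := hG x
    field_simp
  rw [this, abs_mul]
  gcongr
  rw [abs_of_pos (by positivity)]
  exact inv_le_of_inv_le₀ (by norm_num) (by linarith)

theorem inv (hu : Tendsto u l (𝓝 0)) (h : Approx l u F G) (hG : ∀ x, G x ≠ 0)
    (hGinv : (fun x => (G x)⁻¹) =O[l] (fun _ => (1 : ℝ))) :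
    Approx l u (fun x => (F x)⁻¹) (fun x => (G x)⁻¹) := by
  have hev := h.eventually_ne_zero hu hG hGinv
  have hF : (fun x => (F x)⁻¹) =O[l] (fun _ => (1 : ℝ)) :=
    (IsBigO.of_bound 2 (hev.mono fun x hx => hx.2)).trans hGinv
  refine ⟨?_, hF, hGinv⟩
  have h1 := (h.sub.neg_left.mul hF).mul hGinv
  simp only [mul_one] at h1
  refine h1.congr' ?_ .rfl
  filter_upwards [hev] with x hx
  have := hG x
  have := hx.1
  field_simp
  ring

theorem of_sq (hu : Tendsto u l (𝓝 0)) (h : Approx l u (fun x => F x ^ 2) (fun x => G x ^ 2))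
    (hF : ∀ x, 0 ≤ F x) (hG : ∀ x, 0 < G x)
    (hG1 : G =O[l] (fun _ => (1 : ℝ)))
    (hGinv : (fun x => (G x)⁻¹) =O[l] (fun _ => (1 : ℝ))) :
    Approx l u F G := by
  have h1 := h.sub.mul hGinv
  simp only [mul_one] at h1
  refine of_sub hu (IsBigO.trans (isBigO_of_le l fun x => ?_) h1) hG1
  have hx := hG x
  have hFx := hF x
  have : (F x ^ 2 - G x ^ 2) * (G x)⁻¹ = (F x - G x) * ((F x + G x) / G x) := by
    field_simp; ring
  rw [this, norm_mul]
  refine le_mul_of_one_le_right (norm_nonneg _) ?_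
  rw [Real.norm_of_nonneg (by positivity), one_le_div hx]
  linarith

end Approx

/-! ### The Euclidean dot and cross products in coordinates -/

theorem dot3_self (a : E3) : dot3 a a = ‖a‖ ^ 2 := by
  rw [EuclideanSpace.norm_sq_eq, Fin.sum_univ_three]
  simp only [dot3, Real.norm_eq_abs, sq_abs]
  ring

theorem cross3_apply_zero (a b : E3) : cross3 a b 0 = a 1 * b 2 - a 2 * b 1 := rfl

theorem cross3_apply_one (a b : E3) : cross3 a b 1 = a 2 * b 0 - a 0 * b 2 := rfl

theorem cross3_apply_two (a b : E3) : cross3 a b 2 = a 0 * b 1 - a 1 * b 0 := rfl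

/-- Lagrange's identity. -/
theorem dot3_cross3_self (a b : E3) :
    dot3 (cross3 a b) (cross3 a b) = dot3 a a * dot3 b b - dot3 a b ^ 2 := by
  simp only [dot3, cross3_apply_zero, cross3_apply_one, cross3_apply_two]
  ring

theorem dot3_cross3_right (a b : E3) : dot3 (cross3 a b) b = 0 := by
  simp only [dot3, cross3_apply_zero, cross3_apply_one, cross3_apply_two]
  ring

theorem dot3_add_right (a b c : E3) : dot3 a (b + c) = dot3 a b + dot3 a c := by
  simp only [dot3, PiLp.add_apply]
  ring

theorem dot3_smul_right (r : ℝ) (a b : E3) : dot3 a (r • b) = r * dot3 a b := by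
  simp only [dot3, PiLp.smul_apply, smul_eq_mul]
  ring

theorem cross3_smul_right (r : ℝ) (a b : E3) : cross3 a (r • b) = r • cross3 a b := by
  ext i
  fin_cases i <;>
    simp only [Fin.zero_eta, Fin.mk_one, Fin.reduceFinMk, cross3_apply_zero, cross3_apply_one,
      cross3_apply_two, PiLp.smul_apply, smul_eq_mul] <;> ring

theorem Approx.dot3 {X : Type*} {l : Filter X} {u : X → ℝ} {A A' B B' : X → E3}
    (hA : ∀ i, Approx l u (fun x => A x i) (fun x => A' x i))
    (hB : ∀ i, Approx l u (fun x => B x i) (fun x => B' x i)) :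
    Approx l u (fun x => dot3 (A x) (B x)) (fun x => dot3 (A' x) (B' x)) :=
  (((hA 0).mul (hB 0)).add ((hA 1).mul (hB 1))).add ((hA 2).mul (hB 2))

theorem Approx.cross3 {X : Type*} {l : Filter X} {u : X → ℝ} {A A' B B' : X → E3}
    (hA : ∀ i, Approx l u (fun x => A x i) (fun x => A' x i))
    (hB : ∀ i, Approx l u (fun x => B x i) (fun x => B' x i)) (i : Fin 3) :
    Approx l u (fun x => cross3 (A x) (B x) i) (fun x => cross3 (A' x) (B' x) i) := by
  fin_cases i
  · exact ((hA 1).mul (hB 2)).sub' ((hA 2).mul (hB 1))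
  · exact ((hA 2).mul (hB 0)).sub' ((hA 0).mul (hB 2))
  · exact ((hA 0).mul (hB 1)).sub' ((hA 1).mul (hB 0))

theorem isBigO_apply {X : Type*} {l : Filter X} {u : X → ℝ} {A : X → E3} (h : A =O[l] u)
    (i : Fin 3) : (fun x => A x i) =O[l] u :=
  (isBigO_of_le l fun x => PiLp.norm_apply_le (A x) i).trans h

theorem approx_of_eq_add {X : Type*} {l : Filter X} {u v : X → ℝ} {A A' R : X → E3}
    (hu : Tendsto u l (𝓝 0)) (hv : v =O[l] u) (h : ∀ᶠ x in l, A x = A' x + v x • R x)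
    (hA' : A' =O[l] (fun _ => (1 : ℝ))) (hR : R =O[l] (fun _ => (1 : ℝ))) (i : Fin 3) :
    Approx l u (fun x => A x i) (fun x => A' x i) := by
  refine Approx.of_sub hu ?_ (isBigO_apply hA' i)
  have h1 : (fun x => v x • R x) =O[l] u := by simpa using hv.smul hR
  refine (isBigO_apply h1 i).congr' ?_ .rfl
  filter_upwards [h] with x hx
  simp [hx]

theorem contDiff_cross3 {n : WithTop ℕ∞} {a b : ℝ → E3} (ha : ContDiff ℝ n a)
    (hb : ContDiff ℝ n b) : ContDiff ℝ n (fun t => cross3 (a t) (b t)) := by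
  rw [contDiff_euclidean] at ha hb ⊢
  intro i
  fin_cases i
  · exact ((ha 1).mul (hb 2)).sub ((ha 2).mul (hb 1))
  · exact ((ha 2).mul (hb 0)).sub ((ha 0).mul (hb 2))
  · exact ((ha 0).mul (hb 1)).sub ((ha 1).mul (hb 0))

/-! ### Smooth periodic functions -/

/-- Smooth `ℓ`-periodic functions of one real variable. -/
structure SmoothPeriodic {V : Type*} [NormedAddCommGroup V] [NormedSpace ℝ V] (ℓ : ℝ)
    (p : ℝ → V) : Prop where
  smooth : ContDiff ℝ (⊤ : ℕ∞) p
  periodic : Function.Periodic p ℓ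

namespace SmoothPeriodic

variable {V : Type*} [NormedAddCommGroup V] [NormedSpace ℝ V] {ℓ : ℝ} {p : ℝ → V}

theorem deriv (h : SmoothPeriodic ℓ p) : SmoothPeriodic ℓ (deriv p) where
  smooth := (contDiff_infty_iff_deriv.1 h.smooth).2
  periodic t := by
    rw [← deriv_comp_add_const, funext h.periodic]

theorem neg (h : SmoothPeriodic ℓ p) : SmoothPeriodic ℓ (-p) where
  smooth := h.smooth.neg
  periodic t := congrArg Neg.neg (h.periodic t)

theorem smul {c : ℝ → ℝ} (hc : SmoothPeriodic ℓ c) (h : SmoothPeriodic ℓ p) :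
    SmoothPeriodic ℓ (fun t => c t • p t) where
  smooth := hc.smooth.smul h.smooth
  periodic t := by simp only [hc.periodic t, h.periodic t]

theorem hasDerivAt (h : SmoothPeriodic ℓ p) (t : ℝ) : HasDerivAt p (_root_.deriv p t) t :=
  (h.smooth.differentiable (by simp)).differentiableAt.hasDerivAt

theorem isBigO_one (h : SmoothPeriodic ℓ p) (hℓ : 0 < ℓ) (l : Filter (ℝ × ℝ)) :
    (fun x : ℝ × ℝ => p x.2) =O[l] (fun _ => (1 : ℝ)) := by
  obtain ⟨C, hC⟩ :=
    (h.periodic.isBounded_of_continuous hℓ.ne' h.smooth.continuous).exists_norm_le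
  exact isBigO_of_le' l (c := C) fun x => by simpa using hC _ (Set.mem_range_self x.2)

end SmoothPeriodic

/-! ### Rapidly rotating combinations -/

/-- The combination of `p` and `q` rotating at angular speed `η⁻¹`. -/
def rotating (p q : ℝ → E3) (η α : ℝ) : E3 :=
  Real.cos (α / η) • p α + Real.sin (α / η) • q α

theorem rotating_isBigO_one {ℓ : ℝ} {p q : ℝ → E3} (hℓ : 0 < ℓ) (hp : SmoothPeriodic ℓ p)
    (hq : SmoothPeriodic ℓ q) (l : Filter (ℝ × ℝ)) :
    (fun x : ℝ × ℝ => rotating p q x.1 x.2) =O[l] (fun _ => (1 : ℝ)) := by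
  have hc : (fun x : ℝ × ℝ => Real.cos (x.2 / x.1)) =O[l] (fun _ => (1 : ℝ)) :=
    isBigO_of_le l fun x => by simpa using Real.abs_cos_le_one _
  have hs : (fun x : ℝ × ℝ => Real.sin (x.2 / x.1)) =O[l] (fun _ => (1 : ℝ)) :=
    isBigO_of_le l fun x => by simpa using Real.abs_sin_le_one _
  have h1 := hc.smul (hp.isBigO_one hℓ l)
  have h2 := hs.smul (hq.isBigO_one hℓ l)
  simp only [smul_eq_mul, mul_one] at h1 h2
  exact h1.add h2

theorem hasDerivAt_pow_smul_rotating {ℓ : ℝ} {p q : ℝ → E3} (hp : SmoothPeriodic ℓ p)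
    (hq : SmoothPeriodic ℓ q) {η : ℝ} (hη : η ≠ 0) (k : ℕ) (α : ℝ) :
    HasDerivAt (fun t => η ^ (k + 1) • rotating p q η t)
      (η ^ (k + 1) • rotating (deriv p) (deriv q) η α + η ^ k • rotating q (-p) η α) α := by
  have hd : HasDerivAt (fun t : ℝ => t / η) (1 / η) α := (hasDerivAt_id α).div_const η
  have h := (((hd.cos.smul (hp.hasDerivAt α)).add (hd.sin.smul (hq.hasDerivAt α))).const_smul
    (η ^ (k + 1)))
  refine h.congr_deriv ?_
  ext i
  simp only [rotating, PiLp.smul_apply, PiLp.add_apply, PiLp.neg_apply, Pi.neg_apply, smul_eq_mul]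
  field_simp
  ring

section Derivatives

variable {ℓ : ℝ} {g p q : ℝ → E3} {η : ℝ}

theorem deriv_add_rotating (hg : SmoothPeriodic ℓ g) (hp : SmoothPeriodic ℓ p)
    (hq : SmoothPeriodic ℓ q) (hη : η ≠ 0) :
    deriv (fun t => g t + η ^ 3 • rotating p q η t) = fun t => deriv g t +
      (η ^ 3 • rotating (deriv p) (deriv q) η t + η ^ 2 • rotating q (-p) η t) :=
  funext fun t => ((hg.hasDerivAt t).add (hasDerivAt_pow_smul_rotating hp hq hη 2 t)).deriv

theorem deriv_deriv_add_rotating (hg : SmoothPeriodic ℓ g) (hp : SmoothPeriodic ℓ p)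
    (hq : SmoothPeriodic ℓ q) (hη : η ≠ 0) :
    deriv (deriv (fun t => g t + η ^ 3 • rotating p q η t)) = fun t => deriv (deriv g) t +
      ((η ^ 3 • rotating (deriv (deriv p)) (deriv (deriv q)) η t +
          η ^ 2 • rotating (deriv q) (-deriv p) η t) +
        (η ^ 2 • rotating (deriv q) (deriv (-p)) η t + η ^ 1 • rotating (-p) (-q) η t)) := by
  rw [deriv_add_rotating hg hp hq hη]
  exact funext fun t => ((hg.deriv.hasDerivAt t).add
    ((hasDerivAt_pow_smul_rotating hp.deriv hq.deriv hη 2 t).add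
      (hasDerivAt_pow_smul_rotating hq hp.neg hη 1 t))).deriv

theorem deriv_deriv_deriv_add_rotating (hg : SmoothPeriodic ℓ g) (hp : SmoothPeriodic ℓ p)
    (hq : SmoothPeriodic ℓ q) (hη : η ≠ 0) :
    deriv (deriv (deriv (fun t => g t + η ^ 3 • rotating p q η t))) = fun t =>
      deriv (deriv (deriv g)) t +
      (((η ^ 3 • rotating (deriv (deriv (deriv p))) (deriv (deriv (deriv q))) η t +
            η ^ 2 • rotating (deriv (deriv q)) (-deriv (deriv p)) η t) +
          (η ^ 2 • rotating (deriv (deriv q)) (deriv (-deriv p)) η t +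
            η ^ 1 • rotating (-deriv p) (-deriv q) η t)) +
        ((η ^ 2 • rotating (deriv (deriv q)) (deriv (deriv (-p))) η t +
            η ^ 1 • rotating (deriv (-p)) (-deriv q) η t) +
          (η ^ 1 • rotating (deriv (-p)) (deriv (-q)) η t +
            η ^ 0 • rotating (-q) (- -p) η t))) := by
  rw [deriv_deriv_add_rotating hg hp hq hη]
  exact funext fun t => ((hg.deriv.deriv.hasDerivAt t).add
    (((hasDerivAt_pow_smul_rotating hp.deriv.deriv hq.deriv.deriv hη 2 t).add
      (hasDerivAt_pow_smul_rotating hq.deriv hp.deriv.neg hη 1 t)).add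
      ((hasDerivAt_pow_smul_rotating hq.deriv hp.neg.deriv hη 1 t).add
      (hasDerivAt_pow_smul_rotating hp.neg hq.neg hη 0 t)))).deriv

end Derivatives

/-- The filter on pairs `(η, α)` along which `η → 0⁺`, uniformly in `α`. -/
def smallParam : Filter (ℝ × ℝ) := 𝓝[>] (0 : ℝ) ×ˢ ⊤

theorem eventually_smallParam {P : ℝ × ℝ → Prop} :
    (∀ᶠ x in smallParam, P x) ↔
      ∃ η₀ > (0 : ℝ), ∀ η ∈ Set.Ioo (0 : ℝ) η₀, ∀ α, P (η, α) := by
  rw [smallParam, Filter.Eventually, mem_prod_top, mem_nhdsGT_iff_exists_Ioo_subset]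
  rfl

theorem tendsto_fst_smallParam : Tendsto (fun x : ℝ × ℝ => x.1) smallParam (𝓝 0) :=
  tendsto_fst.mono_right nhdsWithin_le_nhds

theorem eventually_fst_pos : ∀ᶠ x in smallParam, 0 < x.1 :=
  eventually_smallParam.2 ⟨1, one_pos, fun _ h _ => h.1⟩

section Expansions

variable {ℓ : ℝ} {g p q : ℝ → E3} {c : ℝ → ℝ → E3}

theorem approx_deriv (hℓ : 0 < ℓ) (hg : SmoothPeriodic ℓ g) (hp : SmoothPeriodic ℓ p)
    (hq : SmoothPeriodic ℓ q) (hc : ∀ η, c η = fun t => g t + η ^ 3 • rotating p q η t)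
    (i : Fin 3) :
    Approx smallParam (fun x => x.1 ^ 2) (fun x => deriv (c x.1) x.2 i)
      (fun x => deriv g x.2 i) := by
  have ht := tendsto_fst_smallParam
  have h1 := ht.isBigO_one ℝ
  refine approx_of_eq_add (v := fun x => x.1 ^ 2)
    (R := fun x => x.1 • rotating (deriv p) (deriv q) x.1 x.2 + rotating q (-p) x.1 x.2)
    (by simpa using ht.pow 2) (isBigO_refl _ _) ?_ (hg.deriv.isBigO_one hℓ _) ?_ i
  · filter_upwards [eventually_fst_pos] with x hx
    rw [hc, deriv_add_rotating hg hp hq hx.ne']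
    module
  · have := h1.smul (rotating_isBigO_one hℓ hp.deriv hq.deriv smallParam)
    simp only [smul_eq_mul, mul_one] at this
    exact this.add (rotating_isBigO_one hℓ hq hp.neg _)

theorem approx_deriv_deriv (hℓ : 0 < ℓ) (hg : SmoothPeriodic ℓ g) (hp : SmoothPeriodic ℓ p)
    (hq : SmoothPeriodic ℓ q) (hc : ∀ η, c η = fun t => g t + η ^ 3 • rotating p q η t)
    (i : Fin 3) :
    Approx smallParam (fun x => x.1) (fun x => deriv (deriv (c x.1)) x.2 i)
      (fun x => deriv (deriv g) x.2 i) := by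
  have ht := tendsto_fst_smallParam
  have key {a b : ℝ → E3} (ha : SmoothPeriodic ℓ a) (hb : SmoothPeriodic ℓ b) (k : ℕ) :
      (fun x : ℝ × ℝ => x.1 ^ k • rotating a b x.1 x.2) =O[smallParam] (fun _ => (1 : ℝ)) := by
    simpa using ((ht.isBigO_one ℝ).pow k).smul (rotating_isBigO_one hℓ ha hb smallParam)
  refine approx_of_eq_add (v := fun x => x.1) (R := fun x =>
      (x.1 ^ 2 • rotating (deriv (deriv p)) (deriv (deriv q)) x.1 x.2 +
        x.1 ^ 1 • rotating (deriv q) (-deriv p) x.1 x.2) +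
      (x.1 ^ 1 • rotating (deriv q) (deriv (-p)) x.1 x.2 +
        x.1 ^ 0 • rotating (-p) (-q) x.1 x.2))
    ht (isBigO_refl _ _) ?_ (hg.deriv.deriv.isBigO_one hℓ _) ?_ i
  · filter_upwards [eventually_fst_pos] with x hx
    rw [hc, deriv_deriv_add_rotating hg hp hq hx.ne']
    module
  · exact ((key hp.deriv.deriv hq.deriv.deriv 2).add (key hq.deriv hp.deriv.neg 1)).add
      ((key hq.deriv hp.neg.deriv 1).add (key hp.neg hq.neg 0))

theorem approx_deriv_deriv_deriv (hℓ : 0 < ℓ) (hg : SmoothPeriodic ℓ g)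
    (hp : SmoothPeriodic ℓ p) (hq : SmoothPeriodic ℓ q)
    (hc : ∀ η, c η = fun t => g t + η ^ 3 • rotating p q η t) (i : Fin 3) :
    Approx smallParam (fun x => x.1) (fun x => deriv (deriv (deriv (c x.1))) x.2 i)
      (fun x => (deriv (deriv (deriv g)) x.2 + rotating (-q) p x.1 x.2) i) := by
  have ht := tendsto_fst_smallParam
  have key {a b : ℝ → E3} (ha : SmoothPeriodic ℓ a) (hb : SmoothPeriodic ℓ b) (k : ℕ) :
      (fun x : ℝ × ℝ => x.1 ^ k • rotating a b x.1 x.2) =O[smallParam] (fun _ => (1 : ℝ)) := by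
    simpa using ((ht.isBigO_one ℝ).pow k).smul (rotating_isBigO_one hℓ ha hb smallParam)
  refine approx_of_eq_add (v := fun x => x.1)
    (A' := fun x => deriv (deriv (deriv g)) x.2 + rotating (-q) p x.1 x.2) (R := fun x =>
      ((x.1 ^ 2 • rotating (deriv (deriv (deriv p))) (deriv (deriv (deriv q))) x.1 x.2 +
          x.1 ^ 1 • rotating (deriv (deriv q)) (-deriv (deriv p)) x.1 x.2) +
        (x.1 ^ 1 • rotating (deriv (deriv q)) (deriv (-deriv p)) x.1 x.2 +
          x.1 ^ 0 • rotating (-deriv p) (-deriv q) x.1 x.2)) +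
      ((x.1 ^ 1 • rotating (deriv (deriv q)) (deriv (deriv (-p))) x.1 x.2 +
          x.1 ^ 0 • rotating (deriv (-p)) (-deriv q) x.1 x.2) +
        x.1 ^ 0 • rotating (deriv (-p)) (deriv (-q)) x.1 x.2))
    ht (isBigO_refl _ _) ?_
    ((hg.deriv.deriv.deriv.isBigO_one hℓ _).add (rotating_isBigO_one hℓ hq.neg hp _)) ?_ i
  · filter_upwards [eventually_fst_pos] with x hx
    rw [hc, deriv_deriv_deriv_add_rotating hg hp hq hx.ne', neg_neg]
    module
  · exact (((key hp.deriv.deriv.deriv hq.deriv.deriv.deriv 2).add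
      (key hq.deriv.deriv hp.deriv.deriv.neg 1)).add
      ((key hq.deriv.deriv hp.deriv.neg.deriv 1).add (key hp.deriv.neg hq.deriv.neg 0))).add
      (((key hq.deriv.deriv hp.neg.deriv.deriv 1).add (key hp.neg.deriv hq.deriv.neg 0)).add
      (key hp.neg.deriv hq.neg.deriv 0))

end Expansions

theorem dot3_deriv_eq_zero {v : ℝ → E3} (hv : Differentiable ℝ v) (h : ∀ t, ‖v t‖ = 1) (t : ℝ) :
    dot3 (v t) (deriv v t) = 0 := by
  have hi (i : Fin 3) : HasDerivAt (fun s => v s i) (deriv v t i) t :=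
    (EuclideanSpace.proj (𝕜 := ℝ) i).hasFDerivAt.comp_hasDerivAt t (hv t).hasDerivAt
  have h1 := (((hi 0).mul (hi 0)).add ((hi 1).mul (hi 1))).add ((hi 2).mul (hi 2))
  have h2 : HasDerivAt (fun s => dot3 (v s) (v s)) 0 t := by
    simpa only [dot3_self, h] using hasDerivAt_const t ((1 : ℝ) ^ 2)
  have h3 := h1.unique h2
  simp only [dot3]
  linarith

/-- A rapidly rotating small-amplitude helicoidal perturbation of a closed curve:
it is `C²`-small, keeps the curvature `O(η)`-close, and shifts the torsion by
`(f/κ)·cos(α/η)` up to `O(η)`. -/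
theorem stmt13
    (ℓ : ℝ) (hℓ : 0 < ℓ)
    (γ : ℝ → E3) (hγ : ContDiff ℝ (⊤ : ℕ∞) γ) (hper : ∀ α, γ (α + ℓ) = γ α)
    (harc : ∀ α, ‖deriv γ α‖ = 1)
    (κ : ℝ → ℝ) (hκ : ∀ α, κ α = ‖deriv (deriv γ) α‖) (hκpos : ∀ α, 0 < κ α)
    (e₁ e₂ : ℝ → E3)
    (he₁ : ∀ α, e₁ α = (κ α)⁻¹ • deriv (deriv γ) α)
    (he₂ : ∀ α, e₂ α = cross3 (deriv γ α) (e₁ α))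
    (τ : ℝ → ℝ)
    (hτ : ∀ α, τ α =
      dot3 (cross3 (deriv γ α) (deriv (deriv γ) α)) (deriv (deriv (deriv γ)) α) / (κ α) ^ 2)
    (f : ℝ → ℝ) (hf : ContDiff ℝ (⊤ : ℕ∞) f) (hfper : ∀ α, f (α + ℓ) = f α)
    (γη : ℝ → ℝ → E3)
    (hγη : ∀ η α, γη η α = γ α -
      (η ^ 3 * f α) • (Real.cos (α / η) • e₁ α + Real.sin (α / η) • e₂ α)) :
    ∃ C > (0:ℝ), ∃ η₀ > (0:ℝ), ∀ η ∈ Set.Ioo (0:ℝ) η₀, ∀ α : ℝ,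
      |‖deriv (γη η) α‖ ^ 2 - 1| ≤ C * η ^ 2 ∧
      cross3 (deriv (γη η) α) (deriv (deriv (γη η)) α) ≠ 0 ∧
      |‖cross3 (deriv (γη η) α) (deriv (deriv (γη η)) α)‖ / ‖deriv (γη η) α‖ ^ 3 - κ α|
        ≤ C * η ∧
      |dot3 (cross3 (deriv (γη η) α) (deriv (deriv (γη η)) α))
            (deriv (deriv (deriv (γη η))) α) /
          ‖cross3 (deriv (γη η) α) (deriv (deriv (γη η)) α)‖ ^ 2
        - τ α - (f α / κ α) * Real.cos (α / η)| ≤ C * η := by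
  have hγs : SmoothPeriodic ℓ γ := ⟨hγ, hper⟩
  have hκs : SmoothPeriodic ℓ κ := by
    refine ⟨?_, fun t => by rw [hκ, hκ, hγs.deriv.deriv.periodic t]⟩
    rw [funext hκ]
    exact hγs.deriv.deriv.smooth.norm ℝ fun t => norm_pos_iff.1 (hκ t ▸ hκpos t)
  have hκis : SmoothPeriodic ℓ (fun t => (κ t)⁻¹) :=
    ⟨hκs.smooth.inv fun t => (hκpos t).ne', fun t => congrArg _ (hκs.periodic t)⟩
  have he₁s : SmoothPeriodic ℓ e₁ := by
    rw [funext he₁]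
    exact hκis.smul hγs.deriv.deriv
  have he₂s : SmoothPeriodic ℓ e₂ := by
    rw [funext he₂]
    exact ⟨contDiff_cross3 hγs.deriv.smooth he₁s.smooth,
      fun t => by simp only [hγs.deriv.periodic t, he₁s.periodic t]⟩
  have hfs : SmoothPeriodic ℓ f := ⟨hf, hfper⟩
  have hp := (hfs.smul he₁s).neg
  have hq := (hfs.smul he₂s).neg
  have hc : ∀ η, γη η = fun t => γ t + η ^ 3 •
      rotating (-fun t => f t • e₁ t) (-fun t => f t • e₂ t) η t := by
    intro η
    funext t
    simp only [hγη, rotating, Pi.neg_apply]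
    module
  have hu := tendsto_fst_smallParam
  have hu2 : Tendsto (fun x : ℝ × ℝ => x.1 ^ 2) smallParam (𝓝 0) := by simpa using hu.pow 2
  have hA2 := approx_deriv hℓ hγs hp hq hc
  have hA (i : Fin 3) : Approx smallParam (fun x => x.1) (fun x => deriv (γη x.1) x.2 i)
      (fun x => deriv γ x.2 i) := by
    refine ⟨(hA2 i).sub.trans ?_, (hA2 i).left, (hA2 i).right⟩
    simpa [sq] using (isBigO_refl (fun x : ℝ × ℝ => x.1) smallParam).mul (hu.isBigO_one ℝ)
  have hB := approx_deriv_deriv hℓ hγs hp hq hc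
  have hD := approx_deriv_deriv_deriv hℓ hγs hp hq hc
  -- the geometry of the unperturbed frame
  have hTT (t : ℝ) : dot3 (deriv γ t) (deriv γ t) = 1 := by rw [dot3_self, harc, one_pow]
  have hcross (t : ℝ) : dot3 (cross3 (deriv γ t) (deriv (deriv γ) t))
      (cross3 (deriv γ t) (deriv (deriv γ) t)) = κ t ^ 2 := by
    rw [dot3_cross3_self, hTT, dot3_self, ← hκ,
      dot3_deriv_eq_zero (hγs.deriv.smooth.differentiable (by simp)) harc]
    ring
  have htriple (x : ℝ × ℝ) : dot3 (cross3 (deriv γ x.2) (deriv (deriv γ) x.2))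
      (deriv (deriv (deriv γ)) x.2 +
        rotating (- -fun t => f t • e₂ t) (-fun t => f t • e₁ t) x.1 x.2) * (κ x.2 ^ 2)⁻¹ =
      τ x.2 + f x.2 / κ x.2 * Real.cos (x.2 / x.1) := by
    have := (hκpos x.2).ne'
    simp only [rotating, neg_neg, Pi.neg_apply, ← neg_smul, dot3_add_right, dot3_smul_right, he₁,
      he₂, cross3_smul_right, dot3_cross3_right, hcross, hτ]
    field_simp
    ring
  have hκ1 := hκs.isBigO_one hℓ smallParam
  have hκi := hκis.isBigO_one hℓ smallParam
  have hκi2 : (fun x : ℝ × ℝ => (κ x.2 ^ 2)⁻¹) =O[smallParam] (fun _ => (1 : ℝ)) := by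
    simpa using hκi.pow 2
  -- the speed, the curvature and the torsion of the perturbed curve
  have hspeed2 := Approx.dot3 hA2 hA2
  have hspeed := Approx.dot3 hA hA
  simp only [hTT, dot3_self] at hspeed2 hspeed
  have hspeed1 : Approx smallParam (fun x => x.1) (fun x => ‖deriv (γη x.1) x.2‖)
      (fun _ => 1) :=
    Approx.of_sq hu (by simpa using hspeed) (fun _ => norm_nonneg _) (fun _ => one_pos)
      (isBigO_refl _ _) (by simp only [inv_one]; exact isBigO_refl _ _)
  have hspeed3 := (hspeed1.pow 3).inv hu (by simp) (by
    simp only [one_pow, inv_one]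
    exact isBigO_refl _ _)
  have hX := Approx.dot3 (Approx.cross3 hA hB) (Approx.cross3 hA hB)
  simp only [hcross, dot3_self] at hX
  have hX1 := Approx.of_sq hu hX (fun _ => norm_nonneg _) (fun x => hκpos x.2) hκ1 hκi
  have hne := hX.eventually_ne_zero hu (fun x => pow_ne_zero 2 (hκpos x.2).ne') hκi2
  have hXi := hX.inv hu (fun x => pow_ne_zero 2 (hκpos x.2).ne') hκi2
  have hcurv := (hX1.mul hspeed3).sub
  have htors := ((Approx.dot3 (Approx.cross3 hA hB) hD).mul hXi).sub
  simp only [htriple] at htors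
  obtain ⟨C₁, h₁⟩ := hspeed2.sub.bound
  obtain ⟨C₂, h₂⟩ := hcurv.bound
  obtain ⟨C₃, h₃⟩ := htors.bound
  refine ⟨max 1 (max C₁ (max C₂ C₃)), by positivity, ?_⟩
  obtain ⟨η₀, hη₀, hev⟩ := eventually_smallParam.1
    (eventually_fst_pos.and (hne.and (h₁.and (h₂.and h₃))))
  refine ⟨η₀, hη₀, fun η hη α => ?_⟩
  obtain ⟨hx, hnex, h₁, h₂, h₃⟩ := hev η hη α
  simp only [Real.norm_eq_abs, abs_of_pos hx, abs_of_pos (pow_pos hx 2)] at h₁ h₂ h₃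
  refine ⟨h₁.trans ?_, fun h0 => hnex.1 (by simp [h0]), ?_, ?_⟩
  · gcongr
    simp
  · simp only [one_pow, inv_one, mul_one, ← div_eq_mul_inv] at h₂
    refine h₂.trans ?_
    gcongr
    simp
  · rw [sub_sub, div_eq_mul_inv]
    refine h₃.trans ?_
    gcongr
    simp
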